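/- For every n ≥ 4, the code C_n of Construction 2 is a complete cyclic 2-skew-tolerant binary Gray code of length n: it lists all 2^n binary vectors of length n, consecutive vectors (cyclically) differ in one coordinate, and consecutive transition positions differ by at most 2. -/

import Mathlib

/-- Codewords `c` and `d` differ exactly at coordinate `i` (1-based), by `±1` there. -/
def TransAt {m : ℕ} (c d : List (ZMod m)) (i : ℕ) : Prop :=
  1 ≤ i ∧ i ≤ c.length ∧ c.length = d.length ∧
  c.take (i-1) = d.take (i-1) ∧ c.drop i = d.drop i ∧
  (d.getD (i-1) 0 = c.getD (i-1) 0 + 1 ∨ d.getD (i-1) 0 = c.getD (i-1) 0 - 1)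

/-- `C` is a cyclic Gray code with transition sequence `δ`. -/
def CyclicGrayWith {m : ℕ} (C : List (List (ZMod m))) (δ : ℕ → ℕ) : Prop :=
  C.Nodup ∧ ∀ i < C.length,
    TransAt (C.getD i []) (C.getD ((i+1) % C.length) []) (δ i)

/-- `C` is a non-cyclic (path) Gray code with transition sequence `δ`. -/
def PathGrayWith {m : ℕ} (C : List (List (ZMod m))) (δ : ℕ → ℕ) : Prop :=
  C.Nodup ∧ ∀ i, i + 1 < C.length →
    TransAt (C.getD i []) (C.getD (i+1) []) (δ i)

/-- cyclic `k`-skew-tolerance. -/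
def SkewCyc (P : ℕ) (δ : ℕ → ℕ) (k : ℤ) : Prop :=
  ∀ i < P, |(δ i : ℤ) - (δ ((i+1) % P) : ℤ)| ≤ k

/-- non-cyclic `k`-skew-tolerance. -/
def SkewPath (P : ℕ) (δ : ℕ → ℕ) (k : ℤ) : Prop :=
  ∀ i, i + 2 < P → |(δ i : ℤ) - (δ (i+1) : ℤ)| ≤ k

/-- the `i`-th standard unit vector (1-based) of length `len` over `ZMod 2`. -/
def unit (len i : ℕ) : List (ZMod 2) :=
  (List.range len).map (fun j => if j + 1 = i then 1 else 0)

/-- pointwise sum of two vectors. -/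
def vadd {m : ℕ} (c d : List (ZMod m)) : List (ZMod m) :=
  List.zipWith (· + ·) c d

/-- `B_{n+1}` from `A_n`: the all-zero word, then `A_n` with `1` appended,
then the reversal of `A_n` minus its first word, with `0` appended. -/
def buildB (An : List (List (ZMod 2))) (len : ℕ) : List (List (ZMod 2)) :=
  List.replicate len (0 : ZMod 2) ::
    (An.map (· ++ [1]) ++ An.tail.reverse.map (· ++ [0]))

/-- Construction 2, codes `A_n` (`n ≥ 3`). -/
def c2A : ℕ → List (List (ZMod 2))
  | 0 => [] | 1 => [] | 2 => []
  | 3 => [[0,0,0],[0,0,1],[0,1,1],[1,1,1],[1,1,0],[1,0,0],[1,0,1]]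
  | (n+4) => (buildB (c2A (n+3)) (n+4)).dropLast ++
      [unit (n+4) (n+2), vadd (unit (n+4) (n+2)) (unit (n+4) (n+4))]

/-- Construction 2, codes `B_n` (`n ≥ 4`). -/
def c2B (n : ℕ) : List (List (ZMod 2)) := buildB (c2A (n-1)) n

/-- Construction 2, codes `C_n` (`n ≥ 4`). -/
def c2C (n : ℕ) : List (List (ZMod 2)) :=
  List.replicate n (0 : ZMod 2) :: unit n (n-2) ::
    vadd (unit n (n-2)) (unit n n) :: (c2B n).tail

/-- The binary words `c` and `d` differ exactly at the (1-based) coordinate `i`. -/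
def FlipAt (c d : List (ZMod 2)) (i : ℕ) : Prop :=
  ∃ p x s, c = p ++ x :: s ∧ d = p ++ (x + 1) :: s ∧ i = p.length + 1

theorem FlipAt.transAt {c d : List (ZMod 2)} {i : ℕ} (h : FlipAt c d i) : TransAt c d i := by
  obtain ⟨p, x, s, rfl, rfl, rfl⟩ := h
  have hp : ∀ y : ZMod 2, (p ++ y :: s).drop (p.length + 1) = s := fun y => by
    rw [← List.drop_drop, List.drop_left]; rfl
  simp [TransAt, hp]

theorem FlipAt.symm {c d : List (ZMod 2)} {i : ℕ} (h : FlipAt c d i) : FlipAt d c i := by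
  obtain ⟨p, x, s, rfl, rfl, rfl⟩ := h
  refine ⟨p, x + 1, s, rfl, ?_, rfl⟩
  have : x + 1 + 1 = x := by revert x; decide
  rw [this]

theorem FlipAt.append_right {c d : List (ZMod 2)} {i : ℕ} (h : FlipAt c d i)
    (t : List (ZMod 2)) : FlipAt (c ++ t) (d ++ t) i := by
  obtain ⟨p, x, s, rfl, rfl, rfl⟩ := h
  exact ⟨p, x, s ++ t, by simp, by simp, rfl⟩

theorem flipAt_of_ne {p s : List (ZMod 2)} {x y : ZMod 2} {i : ℕ} (hxy : x ≠ y)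
    (hi : i = p.length + 1) : FlipAt (p ++ x :: s) (p ++ y :: s) i := by
  refine ⟨p, x, s, rfl, ?_, hi⟩
  have : y = x + 1 := by revert x y; decide
  rw [this]

/-- `FlipWalk L D`: consecutive words of `L` differ at the coordinates listed in `D`. -/
inductive FlipWalk : List (List (ZMod 2)) → List ℕ → Prop
  | single (c : List (ZMod 2)) : FlipWalk [c] []
  | cons {c d : List (ZMod 2)} {L : List (List (ZMod 2))} {i : ℕ} {D : List ℕ} :
      FlipAt c d i → FlipWalk (d :: L) D → FlipWalk (c :: d :: L) (i :: D)

namespace FlipWalk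

variable {L M : List (List (ZMod 2))} {D E : List ℕ}

theorem cons_of_head {c d : List (ZMod 2)} {i : ℕ} (hd : L.head? = some d)
    (hc : FlipAt c d i) (h : FlipWalk L D) : FlipWalk (c :: L) (i :: D) := by
  cases L with
  | nil => simp at hd
  | cons e L => obtain rfl : e = d := by simpa using hd
                exact cons hc h

theorem append {l m : List (ZMod 2)} {i : ℕ} (hL : FlipWalk L D) (hM : FlipWalk M E)
    (hl : L.getLast? = some l) (hm : M.head? = some m) (h : FlipAt l m i) :
    FlipWalk (L ++ M) (D ++ i :: E) := by
  induction hL with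
  | single c => obtain rfl : c = l := by simpa using hl
                exact hM.cons_of_head hm h
  | cons hc _ ih => exact cons hc (ih (by simpa using hl))

theorem reverse (h : FlipWalk L D) : FlipWalk L.reverse D.reverse := by
  induction h with
  | single c => exact single c
  | @cons c d L i D hc _ ih =>
    rw [List.reverse_cons, List.reverse_cons (as := D)]
    exact ih.append (single c) (l := d) (m := c) (by simp) (by simp) hc.symm

theorem map_append (h : FlipWalk L D) (t : List (ZMod 2)) :
    FlipWalk (L.map (· ++ t)) D := by
  induction h with
  | single c => exact single _
  | cons hc _ ih => exact cons (hc.append_right t) ih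

theorem length_eq (h : FlipWalk L D) : L.length = D.length + 1 := by
  induction h with
  | single c => rfl
  | cons _ _ ih => simpa using ih

theorem flipAt_getD (h : FlipWalk L D) :
    ∀ i < D.length, FlipAt (L.getD i []) (L.getD (i + 1) []) (D.getD i 0) := by
  induction h with
  | single c => simp
  | cons hc _ ih =>
    rintro (_ | i) hi
    · simpa using hc
    · simpa using ih i (by simpa using hi)

end FlipWalk

theorem isChain_getD {R : ℕ → ℕ → Prop} {D : List ℕ} (h : D.IsChain R) (i : ℕ)
    (hi : i + 1 < D.length) : R (D.getD i 0) (D.getD (i + 1) 0) := by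
  rw [List.getD_eq_getElem _ _ (by omega), List.getD_eq_getElem _ _ hi]
  exact List.isChain_iff_getElem.mp h i hi

theorem getD_append_head {α : Type*} {L : List α} {a b : α} (ha : L.head? = some a) (i : ℕ)
    (hi : i < L.length) : (L ++ [a]).getD (i + 1) b = L.getD ((i + 1) % L.length) b := by
  rcases Nat.lt_or_eq_of_le (Nat.succ_le_of_lt hi) with h | h
  · rw [Nat.mod_eq_of_lt h, List.getD_append _ _ _ _ h]
  · cases L with
    | nil => simp at hi
    | cons c L => obtain rfl : c = a := by simpa using ha
                  simp only [Nat.succ_eq_add_one] at h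
                  rw [h, Nat.mod_self, List.getD_append_right _ _ _ _ le_rfl]
                  simp

/-- A closed walk gives a cyclic Gray code. -/
theorem cyclic_of_flipWalk {C : List (List (ZMod 2))} {D : List ℕ} {c : List (ZMod 2)} {d : ℕ}
    (hnd : C.Nodup) (hc : C.head? = some c) (hd : D.head? = some d)
    (hw : FlipWalk (C ++ [c]) D)
    (hs : (D ++ [d]).IsChain (fun a b : ℕ => |(a : ℤ) - b| ≤ 2)) :
    ∃ δ : ℕ → ℕ, CyclicGrayWith C δ ∧ SkewCyc C.length δ 2 := by
  have hl : C.length = D.length := by simpa using hw.length_eq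
  refine ⟨fun i => D.getD i 0, ⟨hnd, fun i hi => ?_⟩, fun i hi => ?_⟩
  · have := (hw.flipAt_getD i (hl ▸ hi)).transAt
    rwa [getD_append_head hc i hi, List.getD_append _ _ _ _ hi] at this
  · rw [hl] at hi ⊢
    have := isChain_getD hs i (by simpa using hi)
    rwa [getD_append_head hd i hi, List.getD_append _ _ _ _ hi] at this

/-- The all-zero word of length `k`. -/
abbrev zeros (k : ℕ) : List (ZMod 2) := List.replicate k 0

theorem zeros_succ_append (k : ℕ) (s : List (ZMod 2)) :
    zeros (k + 1) ++ s = zeros k ++ 0 :: s := by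
  simp [zeros, List.replicate_succ']

theorem unit_eq (a b : ℕ) : unit (a + (b + 1)) (a + 1) = zeros a ++ 1 :: zeros b := by
  have h : (List.range a).map (fun j => if j = a then (1 : ZMod 2) else 0) = zeros a :=
    List.eq_replicate_iff.mpr ⟨by simp, fun x hx => by
      obtain ⟨j, hj, rfl⟩ := List.mem_map.mp hx
      exact if_neg (List.mem_range.mp hj).ne⟩
  simp [unit, List.range_add, List.range_succ_eq_map, zeros, h, List.map_const',
    Function.comp_def]

theorem unit_middle (k : ℕ) : unit (k + 4) (k + 2) = zeros (k + 1) ++ [1, 0, 0] :=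
  unit_eq (k + 1) 2

theorem vadd_unit (k : ℕ) :
    vadd (unit (k + 4) (k + 2)) (unit (k + 4) (k + 4)) = zeros (k + 1) ++ [1, 0, 1] := by
  rw [unit_middle, show unit (k + 4) (k + 4) = zeros (k + 1) ++ [0, 0, 1] by
    rw [unit_eq (k + 3) 0, zeros_succ_append, zeros_succ_append]; rfl]
  rw [vadd, List.zipWith_append (by simp)]
  simp [zeros]

/-- The code `c2A (k + 3)` without its first two words. -/
def core : ℕ → List (List (ZMod 2))
  | 0 => [[0,1,1],[1,1,1],[1,1,0],[1,0,0],[1,0,1]]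
  | k + 1 => ((zeros (k + 2) ++ [1, 1]) ::
      ((core k).map (· ++ [1]) ++ ((core k).map (· ++ [0])).reverse)) ++
      [zeros (k + 1) ++ [1, 0, 0], zeros (k + 1) ++ [1, 0, 1]]

/-- The transition sequence of `core k`. -/
def coreTrans : ℕ → List ℕ
  | 0 => [1, 3, 2, 3]
  | k + 1 => ((k + 2) :: (coreTrans k ++ (k + 4) :: (coreTrans k).reverse)) ++ [k + 3, k + 4]

theorem buildB_core (k : ℕ) (h : c2A (k + 3) = zeros (k + 3) :: (zeros (k + 2) ++ [1]) :: core k) :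
    buildB (c2A (k + 3)) (k + 4) = (zeros (k + 4) :: (zeros (k + 3) ++ [1]) ::
      (zeros (k + 2) ++ [1, 1]) :: ((core k).map (· ++ [1]) ++ ((core k).map (· ++ [0])).reverse))
      ++ [zeros (k + 2) ++ [1, 0]] := by
  simp [buildB, h]

theorem c2A_eq (k : ℕ) : c2A (k + 3) = zeros (k + 3) :: (zeros (k + 2) ++ [1]) :: core k := by
  induction k with
  | zero => rfl
  | succ k ih =>
    rw [show c2A (k + 1 + 3) = (buildB (c2A (k+3)) (k+4)).dropLast ++
      [unit (k+4) (k+2), vadd (unit (k+4) (k+2)) (unit (k+4) (k+4))] from rfl,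
      buildB_core k ih, List.dropLast_concat, vadd_unit, unit_middle]
    rfl

theorem c2C_eq (k : ℕ) : c2C (k + 4) = [zeros (k + 4), zeros (k + 1) ++ [1, 0, 0],
      zeros (k + 1) ++ [1, 0, 1], zeros (k + 3) ++ [1], zeros (k + 2) ++ [1, 1]] ++
      ((core k).map (· ++ [1]) ++ ((core k).map (· ++ [0])).reverse) ++
      [zeros (k + 2) ++ [1, 0]] := by
  rw [c2C, show c2B (k + 4) = buildB (c2A (k + 3)) (k + 4) from rfl, buildB_core k (c2A_eq k),
    show k + 4 - 2 = k + 2 from rfl, vadd_unit, unit_middle]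
  rfl

theorem length_core (k : ℕ) : (core k).length + 3 = 2 ^ (k + 3) := by
  induction k with
  | zero => rfl
  | succ k ih => simp [core]; rw [show k + 1 + 3 = (k + 3) + 1 by ring, pow_succ]; omega

theorem length_of_mem_core (k : ℕ) : ∀ c ∈ core k, c.length = k + 3 := by
  induction k with
  | zero => simp [core]
  | succ k ih =>
    intro c hc
    simp only [core, List.cons_append, List.mem_cons, List.mem_append, List.mem_map,
      List.mem_reverse, List.not_mem_nil, or_false] at hc
    rcases hc with rfl | (⟨d, hd, rfl⟩ | ⟨d, hd, rfl⟩) | rfl | rfl <;>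
      simp [*]

theorem head_core (k : ℕ) : (core k).head? = some (zeros (k + 1) ++ [1, 1]) := by
  cases k <;> rfl

theorem exists_last_core (k : ℕ) : ∃ l, (core k).getLast? = some l ∧ l.length = k + 3 := by
  have hne : core k ≠ [] := fun h => by simpa [h] using head_core k
  exact ⟨_, List.getLast?_eq_some_getLast hne,
    length_of_mem_core k _ (List.getLast_mem hne)⟩

theorem mem_core (k : ℕ) : ∀ c : List (ZMod 2), c.length = k + 3 →
    c = zeros (k + 3) ∨ c = zeros (k + 2) ++ [1] ∨ c = zeros (k + 1) ++ [1, 0] ∨ c ∈ core k := by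
  induction k with
  | zero =>
    intro c hc
    obtain ⟨x, y, z, rfl⟩ := List.length_eq_three.mp hc
    revert x y z; decide
  | succ k ih =>
    intro c hc
    rcases List.eq_nil_or_concat c with rfl | ⟨d, x, rfl⟩
    · simp at hc
    rw [List.concat_eq_append] at hc ⊢
    have hx : x = 0 ∨ x = 1 := by
      have : ∀ x : ZMod 2, x = 0 ∨ x = 1 := by decide
      exact this x
    rcases ih d (by simpa using hc) with rfl | rfl | rfl | hd <;> rcases hx with rfl | rfl
    · left; simp [zeros, List.replicate_succ']
    · right; left; rfl
    · right; right; left; simp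
    · simp [core]
    · simp [core]
    · simp [core]
    · simp [core, hd]
    · simp [core, hd]

/-- The doubled core, traversed with last letter `1` and then backwards with last letter `0`. -/
theorem flipWalk_double {k : ℕ} (h : FlipWalk (core k) (coreTrans k)) :
    FlipWalk ((core k).map (· ++ [1]) ++ ((core k).map (· ++ [0])).reverse)
      (coreTrans k ++ (k + 4) :: (coreTrans k).reverse) := by
  obtain ⟨l, hl, hlen⟩ := exists_last_core k
  exact (h.map_append [1]).append (h.map_append [0]).reverse (l := l ++ [1]) (m := l ++ [0])
    (by simp [hl]) (by simp [hl]) (flipAt_of_ne (by decide) (by omega))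

theorem head_double (k : ℕ) :
    ((core k).map (· ++ [(1 : ZMod 2)]) ++ ((core k).map (· ++ [0])).reverse).head? =
      some (zeros (k + 1) ++ [1, 1, 1]) := by
  simp [head_core]

theorem last_double (k : ℕ) :
    ((core k).map (· ++ [(1 : ZMod 2)]) ++ ((core k).map (· ++ [0])).reverse).getLast? =
      some (zeros (k + 1) ++ [1, 1, 0]) := by
  simp [head_core]

theorem flipAt_zeros {k i : ℕ} {x y : ZMod 2} {s : List (ZMod 2)} (hxy : x ≠ y) (hi : i = k + 1) :
    FlipAt (zeros k ++ x :: s) (zeros k ++ y :: s) i :=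
  flipAt_of_ne hxy (by simpa using hi)

theorem flipAt_zeros_append {k i : ℕ} (p s : List (ZMod 2)) (x y : ZMod 2) (hxy : x ≠ y)
    (hi : i = k + p.length + 1) :
    FlipAt (zeros k ++ (p ++ x :: s)) (zeros k ++ (p ++ y :: s)) i := by
  simpa using flipAt_of_ne (p := zeros k ++ p) (s := s) hxy (i := i) (by simpa using hi)

theorem flipWalk_core (k : ℕ) : FlipWalk (core k) (coreTrans k) := by
  induction k with
  | zero =>
    refine .cons ⟨[], 0, [1, 1], rfl, rfl, rfl⟩ (.cons ⟨[1, 1], 1, [], rfl, rfl, rfl⟩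
      (.cons ⟨[1], 1, [0], rfl, rfl, rfl⟩ (.cons ⟨[1, 0], 0, [], rfl, rfl, rfl⟩ (.single _))))
  | succ k ih =>
    refine ((flipWalk_double ih).cons_of_head (head_double k) ?_).append
      (.cons ?_ (.single _)) (l := zeros (k + 1) ++ [1, 1, 0]) ?_ rfl ?_
    · rw [zeros_succ_append]
      exact flipAt_zeros (by decide) rfl
    · exact flipAt_zeros_append [1, 0] [] 0 1 (by decide) rfl
    · rw [List.getLast?_cons, last_double]; rfl
    · exact flipAt_zeros_append [1] [0] 1 0 (by decide) rfl

theorem head_coreTrans (k : ℕ) : (coreTrans k).head? = some (k + 1) := by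
  cases k <;> rfl

theorem last_coreTrans (k : ℕ) : (coreTrans k).getLast? = some (k + 3) := by
  cases k with
  | zero => rfl
  | succ k => rw [coreTrans, List.getLast?_append]; rfl

theorem isChain_double {k : ℕ}
    (h : (coreTrans k).IsChain (fun a b : ℕ => |(a : ℤ) - b| ≤ 2)) :
    (coreTrans k ++ (k + 4) :: (coreTrans k).reverse).IsChain
      (fun a b : ℕ => |(a : ℤ) - b| ≤ 2) := by
  have h' : (coreTrans k).reverse.IsChain (fun a b : ℕ => |(a : ℤ) - b| ≤ 2) := by
    rw [List.isChain_reverse]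
    exact h.imp fun a b hab => by rwa [abs_sub_comm]
  refine List.isChain_append.mpr ⟨h, List.isChain_cons.mpr ⟨?_, h'⟩, ?_⟩
  · simp only [List.head?_reverse, last_coreTrans, Option.mem_def, Option.some.injEq]
    rintro y rfl; push_cast; rw [abs_le]; omega
  · simp only [last_coreTrans, Option.mem_def, Option.some.injEq, List.head?_cons]
    rintro x rfl y rfl; push_cast; rw [abs_le]; omega

theorem isChain_extend {k : ℕ} {P S : List ℕ}
    (h : (coreTrans k).IsChain (fun a b : ℕ => |(a : ℤ) - b| ≤ 2))
    (hP : (P ++ [k + 1]).IsChain (fun a b : ℕ => |(a : ℤ) - b| ≤ 2))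
    (hS : ((k + 1) :: S).IsChain (fun a b : ℕ => |(a : ℤ) - b| ≤ 2)) :
    (P ++ (coreTrans k ++ (k + 4) :: (coreTrans k).reverse) ++ S).IsChain
      (fun a b : ℕ => |(a : ℤ) - b| ≤ 2) := by
  rw [List.isChain_append] at hP
  rw [List.isChain_cons] at hS
  refine List.isChain_append.mpr ⟨List.isChain_append.mpr
    ⟨hP.1, isChain_double h, ?_⟩, hS.2, ?_⟩
  · simpa [head_coreTrans] using hP.2.2
  · simpa [List.getLast?_append, List.getLast?_cons, head_coreTrans] using hS.1

theorem isChain_coreTrans (k : ℕ) :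
    (coreTrans k).IsChain (fun a b : ℕ => |(a : ℤ) - b| ≤ 2) := by
  induction k with
  | zero => simp [coreTrans, abs_le]
  | succ k ih =>
    refine isChain_extend (P := [k + 2]) (S := [k + 3, k + 4]) ih ?_ ?_ <;>
      simp [abs_le] <;> omega

theorem mem_c2C (k : ℕ) (c : List (ZMod 2)) (hc : c.length = k + 4) : c ∈ c2C (k + 4) := by
  rw [c2C_eq]
  rcases mem_core (k + 1) c hc with rfl | rfl | rfl | h
  · simp
  · simp
  · simp
  · simp only [core, List.cons_append, List.mem_cons, List.mem_append, List.not_mem_nil,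
      or_false] at h ⊢
    tauto

theorem length_c2C (k : ℕ) : (c2C (k + 4)).length = 2 ^ (k + 4) := by
  have := length_core k
  rw [c2C_eq]
  simp
  rw [show k + 4 = (k + 3) + 1 by ring, pow_succ]
  omega

theorem nodup_of_forall_mem {n : ℕ} {C : List (List (ZMod 2))} (hl : C.length = 2 ^ n)
    (hC : ∀ c : List (ZMod 2), c.length = n → c ∈ C) : C.Nodup := by
  have hsub : (Finset.univ : Finset (List.Vector (ZMod 2) n)).map
      ⟨fun v => v.1, Subtype.val_injective⟩ ⊆ C.toFinset := fun c hc => by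
    simp only [Finset.mem_map, Finset.mem_univ, true_and] at hc
    obtain ⟨v, rfl⟩ := hc
    exact List.mem_toFinset.mpr (hC _ v.2)
  have hcard := Finset.card_le_card hsub
  rw [Finset.card_map, Finset.card_univ, card_vector, ZMod.card, ← hl] at hcard
  exact Multiset.coe_nodup.mp (Multiset.toFinset_card_eq_card_iff_nodup.mp
    (le_antisymm (List.toFinset_card_le C) hcard))

theorem flipWalk_c2C (k : ℕ) : FlipWalk (c2C (k + 4) ++ [zeros (k + 4)])
    ([k + 2, k + 4, k + 2, k + 3, k + 2] ++
      (coreTrans k ++ (k + 4) :: (coreTrans k).reverse) ++ [k + 2, k + 3]) := by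
  rw [c2C_eq, List.append_assoc]
  have h2 : zeros (k + 4) = zeros (k + 1) ++ [0, 0, 0] := by
    simp [zeros, List.replicate_succ']
  have h3 : zeros (k + 3) ++ [(1 : ZMod 2)] = zeros (k + 1) ++ [0, 0, 1] := by
    simp [zeros, List.replicate_succ']
  have h4 : ∀ x : ZMod 2, zeros (k + 2) ++ [1, x] = zeros (k + 1) ++ [0, 1, x] := by
    simp [zeros, List.replicate_succ']
  rw [h2, h3, h4, h4]
  have hf2 : ∀ a x y z : ZMod 2, x ≠ y →
      FlipAt (zeros (k + 1) ++ [a, x, z]) (zeros (k + 1) ++ [a, y, z]) (k + 3) :=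
    fun a x y z hxy => flipAt_zeros_append [a] [z] x y hxy rfl
  have hf3 : FlipAt (zeros (k + 1) ++ [1, 0, 0]) (zeros (k + 1) ++ [1, 0, 1]) (k + 4) :=
    flipAt_zeros_append [1, 0] [] 0 1 (by decide) rfl
  have hmid : FlipWalk ([zeros (k + 1) ++ [0, 0, 0], zeros (k + 1) ++ [1, 0, 0],
      zeros (k + 1) ++ [1, 0, 1], zeros (k + 1) ++ [0, 0, 1], zeros (k + 1) ++ [0, 1, 1]] ++
      ((core k).map (· ++ [1]) ++ ((core k).map (· ++ [0])).reverse))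
      ([k + 2, k + 4, k + 2, k + 3, k + 2] ++
      (coreTrans k ++ (k + 4) :: (coreTrans k).reverse)) :=
    .cons (flipAt_zeros (by decide) rfl) <| .cons hf3 <|
      .cons (flipAt_zeros (by decide) rfl) <| .cons (hf2 0 0 1 1 (by decide)) <|
      (flipWalk_double (flipWalk_core k)).cons_of_head (head_double k)
        (flipAt_zeros (by decide) rfl)
  refine hmid.append (.cons (hf2 0 1 0 0 (by decide)) (.single _))
    (l := zeros (k + 1) ++ [1, 1, 0]) ?_ rfl (flipAt_zeros (by decide) rfl)
  rw [List.getLast?_append, last_double]; rfl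

theorem stmt6 : ∀ n : ℕ, 4 ≤ n →
    (∀ c ∈ c2C n, c.length = n) ∧ (c2C n).length = 2 ^ n ∧
    (∀ c : List (ZMod 2), c.length = n → c ∈ c2C n) ∧
    ∃ δ : ℕ → ℕ, CyclicGrayWith (c2C n) δ ∧ SkewCyc (c2C n).length δ 2 := by
  intro n hn
  obtain ⟨k, rfl⟩ := Nat.exists_eq_add_of_le' hn
  refine ⟨fun c hc => ?_, length_c2C k, mem_c2C k, ?_⟩
  · rw [c2C_eq] at hc
    simp only [List.mem_cons, List.mem_append, List.mem_map, List.mem_reverse,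
      List.not_mem_nil, or_false] at hc
    rcases hc with ((rfl | rfl | rfl | rfl | rfl) | ⟨d, hd, rfl⟩ | ⟨d, hd, rfl⟩) | rfl <;> simp
    all_goals exact length_of_mem_core k d hd
  · refine cyclic_of_flipWalk (d := k + 2) (nodup_of_forall_mem (length_c2C k) (mem_c2C k)) rfl rfl
      (flipWalk_c2C k) ?_
    rw [List.append_assoc]
    refine isChain_extend (isChain_coreTrans k) ?_ ?_ <;> simp [abs_le] <;> omega
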